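/- Let K₀ be a nonzero real constant and I, J ⊆ ℝ open intervals. There do not exist smooth functions f : I → ℝ and g : J → ℝ with f''(x) ≠ 0 for all x ∈ I and g''(y) ≠ 0 for all y ∈ J (and f, g, f', g' nonvanishing where needed for the division below) such that f(x)g(y)f''(x)g''(y) − (f'(x)g'(y))² = K₀·(1 − (f(x)g'(y))²)² holds for all (x,y) ∈ I×J with 1 − (f(x)g'(y))² ≠ 0. -/

import Mathlib

theorem Set.OrdConnected.injOn_of_deriv_ne_zero {S : Set ℝ} (hS : S.OrdConnected) {φ : ℝ → ℝ}
    (hφ : ∀ x ∈ S, deriv φ x ≠ 0) : S.InjOn φ := by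
  have key : ∀ a ∈ S, ∀ b ∈ S, a < b → φ a ≠ φ b := by
    intro a ha b hb hab h
    have hsub : Set.Icc a b ⊆ S := hS.out ha hb
    obtain ⟨c, hc, hc0⟩ := exists_deriv_eq_zero hab
      (fun x hx => (differentiableAt_of_deriv_ne_zero
        (hφ x (hsub hx))).continuousAt.continuousWithinAt) h
    exact hφ c (hsub (Set.Ioo_subset_Icc_self hc)) hc0
  intro a ha b hb h
  by_contra hne
  rcases lt_or_gt_of_ne hne with hab | hab
  · exact key a ha b hb hab h
  · exact key b hb a ha hab h.symm

theorem Set.OrdConnected.injOn_sq_of_deriv_ne_zero {S : Set ℝ} (hS : S.OrdConnected) {φ : ℝ → ℝ}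
    (hφ : ∀ x ∈ S, φ x ≠ 0) (hφ' : ∀ x ∈ S, deriv φ x ≠ 0) : S.InjOn fun x => φ x ^ 2 := by
  refine hS.injOn_of_deriv_ne_zero fun x hx => ?_
  rw [((differentiableAt_of_deriv_ne_zero (hφ' x hx)).hasDerivAt.fun_pow 2).deriv]
  simpa using ⟨hφ x hx, hφ' x hx⟩

theorem Set.Infinite.exists_injective_fin {α : Type*} {S : Set α} (hS : S.Infinite) (n : ℕ) :
    ∃ x : Fin n → α, Function.Injective x ∧ ∀ i, x i ∈ S := by
  have := hS.to_subtype
  let e := _root_.Infinite.natEmbedding S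
  exact ⟨fun i => e i, fun i j h => Fin.ext (e.injective (Subtype.ext h)), fun i => (e i).2⟩

/-- The `3 × 3` matrix with entries `K * (1 - w i * b j) ^ 2` is nonsingular when the `w i` and
the `b j` are distinct and `K ≠ 0`, so it is not a sum of two rank-one matrices. -/
theorem false_of_sq_one_sub_mul_eq_rank_two {F : Type*} [Field F] [NeZero (2 : F)] {K : F}
    (hK : K ≠ 0) {w b u v a : Fin 3 → F} (hw : Function.Injective w) (hb : Function.Injective b)
    (h : ∀ i j, u i * a j - v i * b j = K * (1 - w i * b j) ^ 2) : False := by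
  have hdet : K ^ 3 * 2 * ((w 0 - w 1) * (w 0 - w 2) * (w 1 - w 2)) *
      ((b 0 - b 1) * (b 0 - b 2) * (b 1 - b 2)) = 0 := by
    calc _ = -(Matrix.of fun i j => K * (1 - w i * b j) ^ 2).det := by
          simp only [Matrix.det_fin_three, Matrix.of_apply]; ring
      _ = -(Matrix.of fun i j => u i * a j - v i * b j).det := by simp only [h]
      _ = 0 := by simp only [Matrix.det_fin_three, Matrix.of_apply]; ring
  simp [hK, NeZero.ne, sub_eq_zero, hw.eq_iff, hb.eq_iff] at hdet

/-- Case b.2: there is no factorable surface of first kind `z(x,y) = f(x) g(y)` with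
`f'' ≠ 0` on `I`, `g'' ≠ 0` on `J` (and `f, f', g, g'` nonvanishing) having nonzero
constant Gaussian curvature `K₀`. -/
theorem no_factorable_first_kind_both_second_derivs_nonzero
    (K₀ : ℝ) (hK₀ : K₀ ≠ 0)
    (I J : Set ℝ) (hIo : IsOpen I) (hIc : I.OrdConnected) (hIn : I.Nonempty)
    (hJo : IsOpen J) (hJc : J.OrdConnected) (hJn : J.Nonempty)
    (f g : ℝ → ℝ) (hf : ContDiffOn ℝ (⊤ : ℕ∞) f I) (hg : ContDiffOn ℝ (⊤ : ℕ∞) g J)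
    (hf'' : ∀ x ∈ I, deriv (deriv f) x ≠ 0)
    (hg'' : ∀ y ∈ J, deriv (deriv g) y ≠ 0)
    (hfne : ∀ x ∈ I, f x ≠ 0) (hf'ne : ∀ x ∈ I, deriv f x ≠ 0)
    (hgne : ∀ y ∈ J, g y ≠ 0) (hg'ne : ∀ y ∈ J, deriv g y ≠ 0)
    (heq : ∀ x ∈ I, ∀ y ∈ J, 1 - (f x * deriv g y) ^ 2 ≠ 0 →
      f x * g y * deriv (deriv f) x * deriv (deriv g) y - (deriv f x * deriv g y) ^ 2
        = K₀ * (1 - (f x * deriv g y) ^ 2) ^ 2) :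
    False := by
  have hw := hIc.injOn_sq_of_deriv_ne_zero hfne hf'ne
  have hb := hJc.injOn_sq_of_deriv_ne_zero hg'ne hg''
  obtain ⟨x₀, hx₀⟩ := hIn
  obtain ⟨y₀, hy₀⟩ := hJn
  obtain ⟨y, hyinj, hy⟩ :=
    (infinite_of_mem_nhds y₀ (hJo.mem_nhds hy₀)).exists_injective_fin 3
  have hfin : (⋃ j, {x ∈ I | 1 - (f x * deriv g (y j)) ^ 2 = 0}).Finite := by
    refine Set.finite_iUnion fun j => Set.Subsingleton.finite ?_
    rintro p ⟨hp, hp0⟩ q ⟨hq, hq0⟩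
    refine hw hp hq (mul_right_cancel₀ (pow_ne_zero 2 (hg'ne _ (hy j))) ?_)
    linear_combination hq0 - hp0
  obtain ⟨x, hxinj, hx⟩ :=
    ((infinite_of_mem_nhds x₀ (hIo.mem_nhds hx₀)).sdiff hfin).exists_injective_fin 3
  refine false_of_sq_one_sub_mul_eq_rank_two hK₀
    (w := fun i => f (x i) ^ 2) (b := fun j => deriv g (y j) ^ 2)
    (u := fun i => f (x i) * deriv (deriv f) (x i)) (v := fun i => deriv f (x i) ^ 2)
    (a := fun j => g (y j) * deriv (deriv g) (y j))
    (fun i j h => hxinj (hw (hx i).1 (hx j).1 h)) (fun i j h => hyinj (hb (hy i) (hy j) h)) ?_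
  intro i j
  have hij := heq (x i) (hx i).1 (y j) (hy j) fun h0 =>
    (hx i).2 (Set.mem_iUnion.2 ⟨j, (hx i).1, h0⟩)
  linear_combination hij
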